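/- Let k ≥ 4 and 3 ≤ n ≤ k−1 be integers. Let σ_{n,k} be the cyclic permutation of P_k defined by σ_{n,k}(1) = n, σ_{n,k}(i) = i+1 for n ≤ i ≤ k−1, σ_{n,k}(k) = n−1, and σ_{n,k}(j) = j−1 for 2 ≤ j ≤ n−1, and let σ_{2,k} be the cyclic permutation of P_k with σ_{2,k}(i) = i+1 for 1 ≤ i ≤ k−1 and σ_{2,k}(k) = 1. Then σ_{2,k} and σ_{n,k} are left similar and two-sided similar, but not right similar; moreover the Petrie matrices M_{σ_{2,k}} and M_{σ_{n,k}} are not similar over ℝ, since they have distinct traces. -/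

import Mathlib

open Matrix

/-- `σ` is a permutation of `P_n = {1,…,n}`, viewed as a function `ℕ → ℕ`. -/
def IsPermOn (n : ℕ) (σ : ℕ → ℕ) : Prop :=
  Set.BijOn σ (Set.Icc 1 n) (Set.Icc 1 n)

/-- The Petrie matrix of a map `σ` on `P_n`: the `(n-1) × (n-1)` real matrix whose
`(i,j)` entry (with `1`-based indices) is `1` iff
`min (σ i) (σ (i+1)) ≤ j ≤ max (σ i) (σ (i+1)) - 1`, and `0` otherwise. -/
def petrie (n : ℕ) (σ : ℕ → ℕ) : Matrix (Fin (n - 1)) (Fin (n - 1)) ℝ :=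
  Matrix.of fun i j =>
    if min (σ (i.1 + 1)) (σ (i.1 + 2)) ≤ j.1 + 1 ∧
        j.1 + 1 ≤ max (σ (i.1 + 1)) (σ (i.1 + 2)) - 1 then 1 else 0

/-- Two square real matrices are similar if `B = P * A * P⁻¹` for some invertible `P`. -/
def MatSimilar {m : Type*} [Fintype m] [DecidableEq m] (A B : Matrix m m ℝ) : Prop :=
  ∃ P : Matrix m m ℝ, IsUnit P ∧ B = P * A * P⁻¹

/-- `σ'` (a permutation of `P_{k+n}`) is a right extension of `σ` (a permutation of `P_k`). -/
def IsRightExt (k n : ℕ) (σ σ' : ℕ → ℕ) : Prop :=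
  IsPermOn (k + n) σ' ∧
  (∀ i, 1 ≤ i → i ≤ k - 1 → σ' i = σ i) ∧
  ∃ t, k + 1 ≤ t ∧ t ≤ k + n ∧ σ' t = σ k ∧
    ∀ j, j ≠ t → k ≤ j → j ≤ k + n → k < σ' j

/-- `(σ', ρ')` is a synchronized right extension of `(σ, ρ)` to `P_{k+n}`. -/
def IsSyncRightExt (k n : ℕ) (σ ρ σ' ρ' : ℕ → ℕ) : Prop :=
  IsRightExt k n σ σ' ∧ IsRightExt k n ρ ρ' ∧
  ∃ t, k + 1 ≤ t ∧ t ≤ k + n ∧ σ' t = σ k ∧ ρ' t = ρ k ∧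
    ∀ i, i ≠ t → k ≤ i → i ≤ k + n → σ' i = ρ' i

/-- `σ'` (a permutation of `P_{m+k}`) is a left extension of `σ` (a permutation of `P_k`). -/
def IsLeftExt (k m : ℕ) (σ σ' : ℕ → ℕ) : Prop :=
  IsPermOn (m + k) σ' ∧
  (∀ i, 2 ≤ i → i ≤ k → σ' (m + i) = m + σ i) ∧
  ∃ s, 1 ≤ s ∧ s ≤ m ∧ σ' s = m + σ 1 ∧
    ∀ j, j ≠ s → 1 ≤ j → j ≤ m + 1 → σ' j < m + 1

/-- `(σ', ρ')` is a synchronized left extension of `(σ, ρ)` to `P_{m+k}`. -/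
def IsSyncLeftExt (k m : ℕ) (σ ρ σ' ρ' : ℕ → ℕ) : Prop :=
  IsLeftExt k m σ σ' ∧ IsLeftExt k m ρ ρ' ∧
  ∃ s, 1 ≤ s ∧ s ≤ m ∧ σ' s = m + σ 1 ∧ ρ' s = m + ρ 1 ∧
    ∀ i, i ≠ s → 1 ≤ i → i ≤ m + 1 → σ' i = ρ' i

/-- `σ'` (a permutation of `P_{m+k+n}`) is a two-sided extension of `σ` (a permutation of `P_k`). -/
def IsTwoSidedExt (k m n : ℕ) (σ σ' : ℕ → ℕ) : Prop :=
  IsPermOn (m + k + n) σ' ∧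
  (∀ i, 2 ≤ i → i ≤ k - 1 → σ' (m + i) = m + σ i) ∧
  (∃ s, 1 ≤ s ∧ s ≤ m ∧ σ' s = m + σ 1 ∧
    ∀ i, i ≠ s → 1 ≤ i → i ≤ m + 1 → σ' i < m + 1) ∧
  (∃ t, m + k + 1 ≤ t ∧ t ≤ m + k + n ∧ σ' t = m + σ k ∧
    ∀ j, j ≠ t → m + k ≤ j → j ≤ m + k + n → m + k < σ' j)

/-- `(σ', ρ')` is a synchronized two-sided extension of `(σ, ρ)` to `P_{m+k+n}`. -/
def IsSyncTwoSidedExt (k m n : ℕ) (σ ρ σ' ρ' : ℕ → ℕ) : Prop :=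
  IsTwoSidedExt k m n σ σ' ∧ IsTwoSidedExt k m n ρ ρ' ∧
  ∃ s t, 1 ≤ s ∧ s ≤ m ∧ m + k + 1 ≤ t ∧ t ≤ m + k + n ∧
    σ' s = m + σ 1 ∧ ρ' s = m + ρ 1 ∧ σ' t = m + σ k ∧ ρ' t = m + ρ k ∧
    ∀ i, i ≠ s → i ≠ t →
      ((1 ≤ i ∧ i ≤ m + 1) ∨ (m + k ≤ i ∧ i ≤ m + k + n)) → σ' i = ρ' i

/-- `σ` and `ρ` (permutations of `P_k`) are right similar. -/
def RightSimilar (k : ℕ) (σ ρ : ℕ → ℕ) : Prop :=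
  ∀ n, 1 ≤ n → ∀ σ' ρ' : ℕ → ℕ, IsSyncRightExt k n σ ρ σ' ρ' →
    MatSimilar (petrie (k + n) σ') (petrie (k + n) ρ')

/-- `σ` and `ρ` (permutations of `P_k`) are left similar. -/
def LeftSimilar (k : ℕ) (σ ρ : ℕ → ℕ) : Prop :=
  ∀ m, 1 ≤ m → ∀ σ' ρ' : ℕ → ℕ, IsSyncLeftExt k m σ ρ σ' ρ' →
    MatSimilar (petrie (m + k) σ') (petrie (m + k) ρ')

/-- `σ` and `ρ` (permutations of `P_k`) are two-sided similar. -/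
def TwoSidedSimilar (k : ℕ) (σ ρ : ℕ → ℕ) : Prop :=
  ∀ m n, 1 ≤ m → 1 ≤ n → ∀ σ' ρ' : ℕ → ℕ, IsSyncTwoSidedExt k m n σ ρ σ' ρ' →
    MatSimilar (petrie (m + k + n) σ') (petrie (m + k + n) ρ')

/-- `σ` and `ρ` (permutations of `P_k`) are right weakly similar. -/
def RightWeaklySimilar (k : ℕ) (σ ρ : ℕ → ℕ) : Prop :=
  ∀ n, 1 ≤ n → ∀ σ' ρ' : ℕ → ℕ, IsSyncRightExt k n σ ρ σ' ρ' →
    (petrie (k + n) σ').charpoly = (petrie (k + n) ρ').charpoly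

/-- The cyclic permutation `σ_{n,k}` of `P_k`:
`σ_{n,k}(1) = n`, `σ_{n,k}(i) = i+1` for `n ≤ i ≤ k-1`, `σ_{n,k}(k) = n-1`,
and `σ_{n,k}(j) = j-1` for `2 ≤ j ≤ n-1`.
(For `n = 2` this is `1→2→⋯→k→1`; for `n = k` this is `1→k→k-1→⋯→2→1`.) -/
def sigmaNK (n k : ℕ) : ℕ → ℕ := fun i =>
  if i = 1 then n
  else if n ≤ i ∧ i ≤ k - 1 then i + 1
  else if i = k then n - 1
  else if 2 ≤ i ∧ i ≤ n - 1 then i - 1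
  else i


/-- The interval vector `e a + e (a+1) + ... + e (b-1)`. -/
def JV {V : Type*} [AddCommGroup V] (e : ℕ → V) (a b : ℕ) : V := ∑ i ∈ Finset.Ico a b, e i

theorem JV_add {V : Type*} [AddCommGroup V] (e : ℕ → V) {a b c : ℕ} (h : a ≤ b) (h' : b ≤ c) :
    JV e a b + JV e b c = JV e a c := Finset.sum_Ico_consecutive e h h'

theorem JV_succ {V : Type*} [AddCommGroup V] (e : ℕ → V) {a b : ℕ} (h : a ≤ b) :
    JV e a (b + 1) = JV e a b + e b := Finset.sum_Ico_succ_top h e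

theorem JV_one {V : Type*} [AddCommGroup V] (e : ℕ → V) (a : ℕ) :
    JV e a (a + 1) = e a := by simp [JV]

/-- The data describing the two Petrie maps `S` (for `σ_{2,k}`) and `T` (for `σ_{n,k}`). -/
structure Setup {V : Type*} [AddCommGroup V] [Module ℝ V] (e : ℕ → V) (S T : V →ₗ[ℝ] V)
    (N m k n : ℕ) : Prop where
  hn : 3 ≤ n
  hnk : n + 1 ≤ k
  hN : m + k ≤ N + 1
  hL : ∀ i, 1 ≤ i → i ≤ m →
    (∃ a b, 1 ≤ a ∧ a ≤ b ∧ b ≤ m + 1 ∧ S (e i) = JV e a b ∧ T (e i) = JV e a b) ∨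
    (∃ a, 1 ≤ a ∧ a ≤ m + 1 ∧ S (e i) = JV e a (m + 2) ∧ T (e i) = JV e a (m + n))
  h1 : ∃ a, 1 ≤ a ∧ a ≤ m + 1 ∧ S (e (m + 1)) = JV e a (m + 3) ∧ T (e (m + 1)) = JV e a (m + 1)
  hS : ∀ i, m + 2 ≤ i → i + 2 ≤ m + k → S (e i) = e (i + 1)
  hT1 : ∀ i, m + 1 ≤ i → i + 3 ≤ m + n → T (e (i + 1)) = e i
  hT2 : T (e (m + n - 1)) = JV e (m + n - 2) (m + n + 1)
  hT3 : ∀ i, m + n ≤ i → i + 2 ≤ m + k → T (e i) = e (i + 1)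
  hH : ∀ i, m + k ≤ i + 1 → i ≤ N →
    (∃ a b, m + k ≤ a ∧ a ≤ b ∧ b ≤ N + 1 ∧ S (e i) = JV e a b ∧ T (e i) = JV e a b) ∨
    (∃ b, m + k ≤ b ∧ b ≤ N + 1 ∧ S (e i) = JV e (m + 1) b ∧ T (e i) = JV e (m + n - 1) b)
  hEx : ∃ i b, m + k ≤ i + 1 ∧ i ≤ N ∧ m + k ≤ b ∧ b ≤ N + 1 ∧ T (e i) = JV e (m + n - 1) b

/-- The images of the edges under the intertwiner. -/
noncomputable def phi {V : Type*} [AddCommGroup V] [Module ℝ V] (e : ℕ → V) (T : V →ₗ[ℝ] V)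
    (m k n : ℕ) (i : ℕ) : V :=
  if i ≤ m then e i else if i = m + 1 then JV e (m + 1) (m + n)
  else if i + 2 ≤ m + k then (T ^ (i - m - 2)) (e (m + n)) else (T ^ (n - 2)) (e i)

section core
variable {V : Type*} [AddCommGroup V] [Module ℝ V] {e : ℕ → V} {S T Φ : V →ₗ[ℝ] V} {N m k n : ℕ}

theorem pow_chain (h : Setup e S T N m k n) (j : ℕ) (hj : j + n + 1 ≤ k) :
    (T ^ j) (e (m + n)) = e (m + n + j) := by
  induction j with
  | zero => simp
  | succ j ih =>
    rw [pow_succ', Module.End.mul_apply, ih (by omega), h.hT3 _ (by omega) (by omega)]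
    rfl

theorem phi_mid (h : Setup e S T N m k n) (j : ℕ) (hj : j + 3 ≤ k) :
    phi e T m k n (m + 2 + j) = (T ^ j) (e (m + n)) := by
  unfold phi
  have := h.hn
  have := h.hnk
  rw [if_neg (by omega), if_neg (by omega)]
  split_ifs with h3
  · congr 2; omega
  · obtain ⟨d, rfl⟩ : ∃ d, k = n + 1 + d := ⟨k - (n + 1), by omega⟩
    have : j = (n - 2) + d := by omega
    rw [this, pow_add, Module.End.mul_apply, pow_chain h d (by omega)]
    congr 2; omega

theorem phi_high (h : Setup e S T N m k n) (i : ℕ) (hi : m + k ≤ i + 1) :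
    phi e T m k n i = (T ^ (n - 2)) (e i) := by
  have := h.hn
  have := h.hnk
  unfold phi
  rw [if_neg (by omega), if_neg (by omega), if_neg (by omega)]

theorem Phi_J_low (hΦ : ∀ i, 1 ≤ i → i ≤ N → Φ (e i) = phi e T m k n i)
    (h : Setup e S T N m k n) {a b : ℕ} (ha : 1 ≤ a) (hb : b ≤ m + 1) :
    Φ (JV e a b) = JV e a b := by
  have := h.hN
  have := h.hn
  have := h.hnk
  unfold JV
  rw [map_sum]
  refine Finset.sum_congr rfl fun i hi => ?_
  rw [Finset.mem_Ico] at hi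
  rw [hΦ i (by omega) (by omega), phi, if_pos (by omega)]

theorem Phi_J_high (hΦ : ∀ i, 1 ≤ i → i ≤ N → Φ (e i) = phi e T m k n i)
    (h : Setup e S T N m k n) {a b : ℕ} (ha : m + k ≤ a + 1) (hb : b ≤ N + 1) :
    Φ (JV e a b) = (T ^ (n - 2)) (JV e a b) := by
  have := h.hN
  have := h.hn
  have := h.hnk
  unfold JV
  rw [map_sum, map_sum]
  refine Finset.sum_congr rfl fun i hi => ?_
  rw [Finset.mem_Ico] at hi
  rw [hΦ i (by omega) (by omega), phi_high h _ (by omega)]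

theorem Phi_one (hΦ : ∀ i, 1 ≤ i → i ≤ N → Φ (e i) = phi e T m k n i)
    (h : Setup e S T N m k n) : Φ (e (m + 1)) = JV e (m + 1) (m + n) := by
  have := h.hN
  have := h.hn
  have := h.hnk
  rw [hΦ _ (by omega) (by omega), phi, if_neg (by omega), if_pos rfl]

theorem T_J_mid (h : Setup e S T N m k n) {a b : ℕ} (ha : m + n ≤ a) (hb : b + 1 ≤ m + k)
    (_hab : a ≤ b) : T (JV e a b) = JV e (a + 1) (b + 1) := by
  unfold JV
  rw [map_sum, ← Finset.sum_Ico_add' e a b 1]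
  refine Finset.sum_congr rfl fun i hi => ?_
  rw [Finset.mem_Ico] at hi
  exact h.hT3 i (by omega) (by omega)

theorem T_J_down (h : Setup e S T N m k n) {a b : ℕ} (ha : m + 1 ≤ a) (hb : b + 2 ≤ m + n) :
    T (JV e (a + 1) (b + 1)) = JV e a b := by
  unfold JV
  rw [map_sum, ← Finset.sum_Ico_add' _ a b 1]
  refine Finset.sum_congr rfl fun i hi => ?_
  rw [Finset.mem_Ico] at hi
  exact h.hT1 i (by omega) (by omega)

theorem T_J_step (h : Setup e S T N m k n) {a : ℕ} (ha : m + 1 ≤ a) (hb : a + 2 ≤ m + n) :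
    T (JV e (a + 1) (m + k)) = JV e a (m + k) + T (e (m + k - 1)) := by
  have := h.hN
  have := h.hn
  have := h.hnk
  obtain ⟨p, hp⟩ : ∃ p, m + n = p + 2 := ⟨m + n - 2, by omega⟩
  obtain ⟨q, hq⟩ : ∃ q, m + k = q + 1 := ⟨m + k - 1, by omega⟩
  have e2 := h.hT2
  rw [← JV_add e (b := p + 1) (by omega) (by omega), ← JV_add e (a := p + 1) (b := p + 2) (by omega) (by omega),
    hq, JV_succ e (a := p + 2) (by omega), JV_one, map_add, map_add, map_add,
    T_J_down h ha (by omega), T_J_mid h (by omega) (by omega) (by omega)]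
  rw [hp] at e2
  simp only [Nat.add_sub_cancel, show p + 2 - 1 = p + 1 from rfl] at e2 ⊢
  rw [e2, ← JV_add e (a := a) (b := p) (c := q + 1) (by omega) (by omega),
    ← JV_add e (a := p) (b := p + 3) (c := q + 1) (by omega) (by omega)]
  abel

theorem T_pow_G (h : Setup e S T N m k n) (j : ℕ) (hj : j + 2 ≤ n) :
    (T ^ j) (JV e (m + n - 1) (m + k)) =
      JV e (m + n - 1 - j) (m + k) + ∑ i ∈ Finset.range j, (T ^ i) (T (e (m + k - 1))) := by
  induction j with
  | zero => simp
  | succ j ih =>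
    rw [pow_succ', Module.End.mul_apply, ih (by omega), map_add]
    obtain ⟨a, ha⟩ : ∃ a, m + n - 1 - j = a + 1 := ⟨m + n - 1 - j - 1, by omega⟩
    rw [ha, T_J_step h (by omega) (by omega), Finset.sum_range_succ', map_sum,
      show m + n - 1 - (j + 1) = a by omega]
    simp only [pow_succ', Module.End.mul_apply, pow_zero, Module.End.one_apply]
    abel

theorem Phi_J_t (hΦ : ∀ i, 1 ≤ i → i ≤ N → Φ (e i) = phi e T m k n i)
    (h : Setup e S T N m k n) {b : ℕ} (hb : m + k ≤ b) (hbN : b ≤ N + 1) :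
    Φ (JV e (m + 1) b) = (T ^ (n - 2)) (JV e (m + n - 1) b) := by
  have hN := h.hN
  have hn := h.hn
  have hnk := h.hnk
  rw [← JV_add e (a := m + 1) (b := m + k) (by omega) hb,
    ← JV_add e (a := m + n - 1) (b := m + k) (by omega) hb, map_add, map_add,
    Phi_J_high hΦ h (a := m + k) (by omega) hbN, T_pow_G h _ (by omega)]
  congr 1
  rw [← JV_add e (a := m + 1) (b := m + 2) (by omega) (by omega), map_add, JV_one, Phi_one hΦ h]
  have e1 : Φ (JV e (m + 2) (m + k)) = ∑ j ∈ Finset.range (k - 2), (T ^ j) (e (m + n)) := by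
    unfold JV
    rw [map_sum, Finset.sum_Ico_eq_sum_range, show m + k - (m + 2) = k - 2 by omega]
    refine Finset.sum_congr rfl fun j hj => ?_
    rw [Finset.mem_range] at hj
    rw [hΦ _ (by omega) (by omega), phi_mid h _ (by omega)]
  have e2 : T (e (m + k - 1)) = (T ^ (k - n)) (e (m + n)) := by
    rw [show k - n = (k - n - 1) + 1 by omega, pow_succ', Module.End.mul_apply,
      pow_chain h _ (by omega)]
    congr 2; omega
  rw [e1, show k - 2 = (k - n) + (n - 2) by omega, Finset.sum_range_add, e2,
    show m + n - 1 - (n - 2) = m + 1 by omega,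
    ← JV_add e (a := m + 1) (b := m + n) (c := m + k) (by omega) (by omega), add_assoc]
  congr 2
  · unfold JV
    rw [Finset.sum_Ico_eq_sum_range, show m + k - (m + n) = k - n by omega]
    refine Finset.sum_congr rfl fun j hj => ?_
    rw [Finset.mem_range] at hj
    exact pow_chain h _ (by omega)
  · refine Finset.sum_congr rfl fun j hj => ?_
    rw [← Module.End.mul_apply, ← pow_add, add_comm]

theorem core_comm (hΦ : ∀ i, 1 ≤ i → i ≤ N → Φ (e i) = phi e T m k n i)
    (h : Setup e S T N m k n) (i : ℕ) (hi : 1 ≤ i) (hiN : i ≤ N) :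
    Φ (S (e i)) = T (Φ (e i)) := by
  have hN := h.hN
  have hn := h.hn
  have hnk := h.hnk
  have hcomm : ∀ x, T ((T ^ (n - 2)) x) = (T ^ (n - 2)) (T x) := fun x => by
    rw [← Module.End.mul_apply, ← Module.End.mul_apply, ← pow_succ, ← pow_succ']
  rcases Nat.lt_or_ge m i with h1 | h1
  · rcases Nat.lt_or_ge (i + 1) (m + k) with h2 | h2
    · rcases Nat.eq_or_lt_of_le h1 with h3 | h3
      · obtain rfl : i = m + 1 := by omega
        obtain ⟨a, ha1, ha2, hS, hT⟩ := h.h1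
        have e2 : Φ (e (m + 2)) = e (m + n) := by
          rw [hΦ _ (by omega) (by omega)]
          simpa using phi_mid h 0 (by omega)
        obtain ⟨p, hp⟩ : ∃ p, m + n = p + 2 := ⟨m + n - 2, by omega⟩
        have hT2 := h.hT2
        have hp' : p = m + n - 2 := by omega
        rw [hS, ← JV_add e (b := m + 1) (by omega) (by omega), JV_succ e (a := m + 1) (by omega),
          JV_one, map_add, map_add, Phi_J_low hΦ h (by omega) (by omega), Phi_one hΦ h, e2]
        rw [hp] at hT2 ⊢
        rw [JV_succ e (a := m + 1) (b := p + 1) (by omega), map_add,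
          ← JV_add e (a := m + 1) (b := m + 2) (by omega) (by omega), JV_one, map_add, hT]
        simp only [Nat.add_sub_cancel, show p + 2 - 1 = p + 1 from rfl] at hT2 ⊢
        rw [hT2, T_J_down h (a := m + 1) (b := p) (by omega) (by omega), ← JV_one e (p + 2),
          ← JV_one e (p + 1), ← JV_one e (m + 1)]
        simp only [add_assoc, Nat.reduceAdd]
        rw [JV_add _ (by omega) (by omega), JV_add _ (by omega) (by omega),
          JV_add _ (by omega) (by omega), JV_add _ (by omega) (by omega),
          JV_add _ (by omega) (by omega), JV_add _ (by omega) (by omega)]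
      · obtain ⟨j, rfl⟩ : ∃ j, i = m + 2 + j := ⟨i - (m + 2), by omega⟩
        rw [h.hS _ (by omega) (by omega), hΦ _ (by omega) (by omega), hΦ _ (by omega) (by omega),
          phi_mid h j (by omega), add_assoc, phi_mid h (j + 1) (by omega), pow_succ',
          Module.End.mul_apply]
    · rw [hΦ i hi hiN, phi_high h i h2, hcomm]
      rcases h.hH i h2 hiN with ⟨a, b, ha, hab, hb, hS, hT⟩ | ⟨b, hb, hbN, hS, hT⟩
      · rw [hS, hT, Phi_J_high hΦ h (by omega) hb]
      · rw [hS, hT, Phi_J_t hΦ h hb hbN]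
  · rw [hΦ i hi hiN, phi, if_pos h1]
    rcases h.hL i hi h1 with ⟨a, b, ha, hab, hb, hS, hT⟩ | ⟨a, ha, hb, hS, hT⟩
    · rw [hS, hT, Phi_J_low hΦ h ha hb]
    · rw [hS, hT, JV_succ e (b := m + 1) (by omega), map_add, Phi_J_low hΦ h ha le_rfl,
        Phi_one hΦ h, JV_add _ (by omega) (by omega)]

theorem J_mem {W : Submodule ℝ V} {a b : ℕ} (h : ∀ i, a ≤ i → i < b → e i ∈ W) : JV e a b ∈ W :=
  Submodule.sum_mem _ fun i hi => by
    rw [Finset.mem_Ico] at hi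
    exact h i hi.1 hi.2

theorem core_surj (hΦ : ∀ i, 1 ≤ i → i ≤ N → Φ (e i) = phi e T m k n i)
    (h : Setup e S T N m k n) (W : Submodule ℝ V) (hW : ∀ x, Φ x ∈ W)
    (hWT : ∀ x ∈ W, T x ∈ W) (hWT' : ∀ x, T x ∈ W → x ∈ W) (i : ℕ) (hi : 1 ≤ i) (hiN : i ≤ N) :
    e i ∈ W := by
  have hN := h.hN
  have hn := h.hn
  have hnk := h.hnk
  have hpow : ∀ j x, (T ^ j) x ∈ W → x ∈ W := by
    intro j
    induction j with
    | zero => intro x hx; simpa using hx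
    | succ j ih =>
      intro x hx
      rw [pow_succ', Module.End.mul_apply] at hx
      exact ih x (hWT' _ hx)
  have high : ∀ i, m + k ≤ i + 1 → i ≤ N → e i ∈ W := fun i h1 h2 => by
    have := hW (e i)
    rw [hΦ i (by omega) h2, phi_high h i h1] at this
    exact hpow _ _ this
  have mid : ∀ i, m + n ≤ i → i ≤ N → e i ∈ W := fun i h1 h2 => by
    rcases Nat.lt_or_ge (i + 1) (m + k) with h3 | h3
    · have := hW (e (m + 2 + (i - (m + n))))
      rw [hΦ _ (by omega) (by omega), phi_mid h _ (by omega), pow_chain h _ (by omega)] at this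
      rwa [show m + n + (i - (m + n)) = i by omega] at this
    · exact high i h3 h2
  have hp : e (m + n - 1) ∈ W := by
    obtain ⟨i, b, h1, h2, h3, h4, h5⟩ := h.hEx
    have h6 := hWT _ (high i h1 h2)
    rw [h5, ← JV_add e (b := m + n) (by omega) (by omega)] at h6
    have h7 := (Submodule.add_mem_iff_left W (J_mem fun i h1 h2 => mid i h1 (by omega))).1 h6
    rw [show m + n = (m + n - 1) + 1 by omega, Nat.add_sub_cancel, JV_one] at h7
    exact h7
  have hp' : e (m + n - 2) ∈ W := by
    have h6 := hWT _ hp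
    rw [h.hT2, ← JV_add e (b := m + n - 1) (by omega) (by omega)] at h6
    have h7 := (Submodule.add_mem_iff_left W (J_mem fun i h1 h2 => by
      rcases Nat.lt_or_ge i (m + n) with h8 | h8
      · rwa [show i = m + n - 1 by omega]
      · exact mid i h8 (by omega))).1 h6
    rw [show m + n - 1 = (m + n - 2) + 1 by omega, JV_one] at h7
    exact h7
  have down : ∀ j, j + 3 ≤ n → e (m + n - 2 - j) ∈ W := by
    intro j
    induction j with
    | zero => intro _; exact hp'
    | succ j ih =>
      intro hj
      have := hWT _ (ih (by omega))
      rw [show m + n - 2 - j = (m + n - 2 - (j + 1)) + 1 by omega, h.hT1 _ (by omega) (by omega)] at this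
      exact this
  rcases Nat.lt_or_ge m i with h1 | h1
  · rcases Nat.lt_or_ge i (m + n) with h2 | h2
    · rcases Nat.eq_or_lt_of_le h2 with h3 | h3
      · rwa [show i = m + n - 1 by omega]
      · have := down (m + n - 2 - i) (by omega)
        rwa [show m + n - 2 - (m + n - 2 - i) = i by omega] at this
    · exact mid i h2 hiN
  · have := hW (e i)
    rwa [hΦ i hi hiN, phi, if_pos h1] at this

end core

/-- The standard basis row vectors, indexed from `1`. -/
def eB (N : ℕ) (i : ℕ) : Fin N → ℝ := fun j => if j.1 + 1 = i then 1 else 0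

theorem JV_eB (N a b : ℕ) :
    JV (eB N) a b = fun j => if a ≤ j.1 + 1 ∧ j.1 + 1 < b then 1 else 0 := by
  ext j
  unfold JV eB
  simp [Finset.sum_apply]

theorem eB_single (N : ℕ) (j : Fin N) : eB N (j.1 + 1) = Pi.single j 1 := by
  ext l
  simp only [eB, Pi.single_apply, Fin.ext_iff]
  congr 1
  simp

theorem eB_vecMul {N : ℕ} (A : Matrix (Fin N) (Fin N) ℝ) (j : Fin N) :
    A.vecMulLinear (eB N (j.1 + 1)) = A j := by
  rw [eB_single, Matrix.vecMulLinear_apply, Matrix.single_one_vecMul]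
  rfl

theorem petrie_row (K : ℕ) (σ : ℕ → ℕ) (i : ℕ) (hi : 1 ≤ i) (hiN : i ≤ K - 1) :
    (petrie K σ).vecMulLinear (eB (K - 1) i) =
      JV (eB (K - 1)) (min (σ i) (σ (i + 1))) (max (σ i) (σ (i + 1))) := by
  obtain ⟨j, rfl⟩ : ∃ j, i = j + 1 := ⟨i - 1, by omega⟩
  rw [eB_vecMul (petrie K σ) ⟨j, by omega⟩, JV_eB]
  ext l
  simp only [petrie, Matrix.of_apply]
  congr 1
  rw [eq_iff_iff]
  refine and_congr Iff.rfl ?_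
  simp only [add_assoc, Nat.reduceAdd]
  omega

theorem span_eB {N : ℕ} (W : Submodule ℝ (Fin N → ℝ)) (h : ∀ i, 1 ≤ i → i ≤ N → eB N i ∈ W)
    (x : Fin N → ℝ) : x ∈ W := by
  rw [pi_eq_sum_univ' x]
  refine W.sum_mem fun j _ => W.smul_mem _ ?_
  have := h (j.1 + 1) (by omega) (by omega)
  rwa [eB_single] at this

theorem petrie_surj (K : ℕ) (σ : ℕ → ℕ) (hσ : IsPermOn K σ) :
    Function.Surjective (petrie K σ).vecMulLinear := by
  intro x
  set W := LinearMap.range (petrie K σ).vecMulLinear with hW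
  suffices h : x ∈ W by simpa [hW] using h
  refine span_eB W (fun i hi hiN => ?_) x
  set v : ℕ → (Fin (K - 1) → ℝ) := fun a => JV (eB (K - 1)) 1 a with hv
  have hmap : ∀ i, 1 ≤ i → i ≤ K → 1 ≤ σ i ∧ σ i ≤ K := fun i h1 h2 => hσ.mapsTo ⟨h1, h2⟩
  have step : ∀ j, 1 ≤ j → j ≤ K - 1 → v (σ (j + 1)) - v (σ j) ∈ W := by
    intro j h1 h2
    have hr := petrie_row K σ j h1 h2
    have hm : (petrie K σ).vecMulLinear (eB (K - 1) j) ∈ W := LinearMap.mem_range_self _ _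
    rw [hr] at hm
    have m1 := hmap j h1 (by omega)
    have m2 := hmap (j + 1) (by omega) (by omega)
    rcases le_total (σ j) (σ (j + 1)) with h | h
    · rw [min_eq_left h, max_eq_right h] at hm
      rw [hv]
      simp only
      rwa [← JV_add _ m1.1 h, add_sub_cancel_left]
    · rw [min_eq_right h, max_eq_left h] at hm
      rw [hv]
      simp only
      rw [← JV_add _ m2.1 h, ← neg_sub, add_sub_cancel_left]
      exact W.neg_mem hm
  have base : ∀ j, j + 1 ≤ K → v (σ (j + 1)) - v (σ 1) ∈ W := by
    intro j
    induction j with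
    | zero => intro _; simp
    | succ j ih =>
      intro hj
      have := W.add_mem (step (j + 1) (by omega) (by omega)) (ih (by omega))
      simpa using this
  have all : ∀ a, 1 ≤ a → a ≤ K → v a - v (σ 1) ∈ W := by
    intro a h1 h2
    obtain ⟨j, ⟨hj1, hj2⟩, rfl⟩ := hσ.surjOn ⟨h1, h2⟩
    have := base (j - 1) (by omega)
    rwa [Nat.sub_add_cancel hj1] at this
  have := W.sub_mem (all (i + 1) (by omega) (by omega)) (all i hi (by omega))
  rw [sub_sub_sub_cancel_right, hv] at this
  simp only at this
  rwa [JV_succ _ hi, add_sub_cancel_left] at this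

theorem similar_of_setup (K m k n : ℕ) (σ ρ : ℕ → ℕ) (hρ : IsPermOn K ρ)
    (h : Setup (eB (K - 1)) (petrie K σ).vecMulLinear (petrie K ρ).vecMulLinear (K - 1) m k n) :
    MatSimilar (petrie K σ) (petrie K ρ) := by
  set A := petrie K σ
  set B := petrie K ρ with hB
  set P : Matrix (Fin (K - 1)) (Fin (K - 1)) ℝ :=
    Matrix.of fun i => phi (eB (K - 1)) B.vecMulLinear m k n (i.1 + 1) with hP
  have hΦ : ∀ i, 1 ≤ i → i ≤ K - 1 →
      P.vecMulLinear (eB (K - 1) i) = phi (eB (K - 1)) B.vecMulLinear m k n i := by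
    intro i h1 h2
    obtain ⟨j, rfl⟩ : ∃ j, i = j + 1 := ⟨i - 1, by omega⟩
    rw [eB_vecMul P ⟨j, by omega⟩]
    rfl
  have hAP : A * P = P * B := by
    ext i l
    have := core_comm hΦ h (i.1 + 1) (by omega) (by omega)
    rw [eB_vecMul, eB_vecMul] at this
    have := congrFun this l
    simpa only [Matrix.vecMulLinear_apply, Matrix.vecMul, Matrix.mul_apply, dotProduct] using this
  have hcomm : ∀ x, B.vecMulLinear (P.vecMulLinear x) = P.vecMulLinear (A.vecMulLinear x) := by
    intro x
    simp only [Matrix.vecMulLinear_apply, Matrix.vecMul_vecMul, hAP]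
  have hinj : Function.Injective B.vecMulLinear :=
    LinearMap.injective_iff_surjective.2 (petrie_surj K ρ hρ)
  set W := LinearMap.range P.vecMulLinear with hW
  have hWT : ∀ x ∈ W, B.vecMulLinear x ∈ W := by
    rintro _ ⟨y, rfl⟩
    rw [hcomm]
    exact LinearMap.mem_range_self _ _
  have hWeq : W.map B.vecMulLinear = W := by
    refine Submodule.eq_of_le_of_finrank_eq ?_ ?_
    · rintro _ ⟨y, hy, rfl⟩
      exact hWT y hy
    · exact (Submodule.equivMapOfInjective B.vecMulLinear hinj W).finrank_eq.symm
  have hWT' : ∀ x, B.vecMulLinear x ∈ W → x ∈ W := by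
    intro x hx
    rw [← hWeq] at hx
    obtain ⟨y, hy, hxy⟩ := hx
    rwa [← hinj hxy]
  have hsurj : Function.Surjective P.vecMul := by
    intro x
    have : x ∈ W := span_eB W (fun i h1 h2 =>
      core_surj hΦ h W (fun x => LinearMap.mem_range_self _ x) hWT hWT' i h1 h2) x
    exact this
  have hu : IsUnit P := Matrix.vecMul_surjective_iff_isUnit.1 hsurj
  have hd : IsUnit P.det := (Matrix.isUnit_iff_isUnit_det P).1 hu
  refine ⟨P⁻¹, (Matrix.isUnit_nonsing_inv_iff).2 hu, ?_⟩
  rw [Matrix.nonsing_inv_nonsing_inv P hd, Matrix.mul_assoc, hAP, ← Matrix.mul_assoc,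
    Matrix.nonsing_inv_mul P hd, Matrix.one_mul]

theorem similar_trace {N : ℕ} {A B : Matrix (Fin N) (Fin N) ℝ} (h : MatSimilar A B) :
    A.trace = B.trace := by
  obtain ⟨P, hP, rfl⟩ := h
  have hd : IsUnit P.det := (Matrix.isUnit_iff_isUnit_det P).1 hP
  rw [Matrix.trace_mul_cycle, Matrix.nonsing_inv_mul P hd, Matrix.one_mul]

theorem trace_two (k : ℕ) (hk : 3 ≤ k) : (petrie k (sigmaNK 2 k)).trace = 1 := by
  have : ∀ i : Fin (k - 1), petrie k (sigmaNK 2 k) i i =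
      if i = (⟨k - 2, by omega⟩ : Fin (k - 1)) then 1 else 0 := by
    intro i
    have := i.2
    simp only [petrie, Matrix.of_apply, Fin.ext_iff]
    congr 1
    rw [eq_iff_iff]
    unfold sigmaNK
    split_ifs <;> omega
  simp only [Matrix.trace, Matrix.diag_apply, this]
  simp

theorem trace_n (n k : ℕ) (hn : 3 ≤ n) (hk : n + 1 ≤ k) : (petrie k (sigmaNK n k)).trace = 3 := by
  have : ∀ i : Fin (k - 1), petrie k (sigmaNK n k) i i =
      (if i = (⟨0, by omega⟩ : Fin (k - 1)) then 1 else 0) +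
      (if i = (⟨n - 2, by omega⟩ : Fin (k - 1)) then 1 else 0) +
      if i = (⟨k - 2, by omega⟩ : Fin (k - 1)) then 1 else 0 := by
    intro i
    have := i.2
    have e : petrie k (sigmaNK n k) i i = if (i.1 = 0 ∨ i.1 = n - 2 ∨ i.1 = k - 2) then 1 else 0 := by
      simp only [petrie, Matrix.of_apply, Fin.ext_iff]
      congr 1
      rw [eq_iff_iff]
      unfold sigmaNK
      split_ifs <;> omega
    rw [e]
    simp only [Fin.ext_iff]
    split_ifs <;> first | omega | norm_num
  simp only [Matrix.trace, Matrix.diag_apply, this, Finset.sum_add_distrib]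
  simp
  norm_num

theorem sigma_perm (n k : ℕ) (hn : 2 ≤ n) (hk : n + 1 ≤ k) : IsPermOn k (sigmaNK n k) := by
  refine ⟨?_, ?_, ?_⟩
  · rintro i ⟨h1, h2⟩
    unfold sigmaNK
    constructor <;> split_ifs <;> omega
  · rintro i ⟨h1, h2⟩ j ⟨h3, h4⟩ hij
    unfold sigmaNK at hij
    split_ifs at hij <;> omega
  · rintro j ⟨h1, h2⟩
    refine ⟨if j = n then 1 else if n < j then j - 1 else if j = n - 1 then k else j + 1, ?_, ?_⟩
    · constructor <;> split_ifs <;> omega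
    · unfold sigmaNK
      split_ifs <;> omega

theorem sigma_rightExt (n k : ℕ) (hn : 2 ≤ n) (hk : n + 1 ≤ k) :
    IsRightExt k 1 (sigmaNK n k) (sigmaNK n (k + 1)) := by
  refine ⟨sigma_perm n (k + 1) hn (by omega), ?_, k + 1, by omega, le_rfl, ?_, ?_⟩
  · intro i h1 h2
    unfold sigmaNK
    split_ifs <;> omega
  · unfold sigmaNK
    split_ifs <;> omega
  · intro j h1 h2 h3
    unfold sigmaNK
    split_ifs <;> omega

theorem not_right (k n : ℕ) (hn : 3 ≤ n) (hn' : n + 1 ≤ k) :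
    ¬ RightSimilar k (sigmaNK 2 k) (sigmaNK n k) := by
  intro h
  have := similar_trace (h 1 le_rfl (sigmaNK 2 (k + 1)) (sigmaNK n (k + 1))
    ⟨sigma_rightExt 2 k le_rfl (by omega), sigma_rightExt n k (by omega) hn', k + 1, by omega,
      le_rfl, ?_, ?_, ?_⟩)
  · rw [trace_two (k + 1) (by omega), trace_n n (k + 1) hn (by omega)] at this
    norm_num at this
  · unfold sigmaNK
    split_ifs <;> omega
  · unfold sigmaNK
    split_ifs <;> omega
  · intro i h1 h2 h3
    unfold sigmaNK
    split_ifs <;> omega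

theorem setup_of_ext (m k n K s t : ℕ) (σ ρ : ℕ → ℕ) (hn : 3 ≤ n) (hnk : n + 1 ≤ k)
    (hK : m + k ≤ K)
    (hs1 : 1 ≤ s) (hs2 : s ≤ m) (hσs : σ s = m + 2) (hρs : ρ s = m + n)
    (ht1 : m + k ≤ t) (ht2 : t ≤ K) (hσt : σ t = m + 1) (hρt : ρ t = m + n - 1)
    (low : ∀ i, i ≠ s → 1 ≤ i → i ≤ m + 1 → σ i = ρ i ∧ 1 ≤ ρ i ∧ ρ i ≤ m)
    (mid : ∀ i, 2 ≤ i → i ≤ k - 1 → σ (m + i) = m + i + 1 ∧ ρ (m + i) = m + sigmaNK n k i)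
    (high : ∀ i, i ≠ t → m + k ≤ i → i ≤ K → σ i = ρ i ∧ m + k < ρ i ∧ ρ i ≤ K) :
    Setup (eB (K - 1)) (petrie K σ).vecMulLinear (petrie K ρ).vecMulLinear (K - 1) m k n := by
  have mid1 : ∀ i, m + 2 ≤ i → i + 1 ≤ m + k → σ i = i + 1 := fun i h1 h2 => by
    have := (mid (i - m) (by omega) (by omega)).1
    rw [show m + (i - m) = i by omega] at this
    omega
  have mid2 : ∀ i, m + 2 ≤ i → i + 1 ≤ m + n → ρ i = i - 1 := fun i h1 h2 => by
    have := (mid (i - m) (by omega) (by omega)).2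
    rw [show m + (i - m) = i by omega] at this
    rw [this]
    unfold sigmaNK
    split_ifs <;> omega
  have mid3 : ∀ i, m + n ≤ i → i + 1 ≤ m + k → ρ i = i + 1 := fun i h1 h2 => by
    have := (mid (i - m) (by omega) (by omega)).2
    rw [show m + (i - m) = i by omega] at this
    rw [this]
    unfold sigmaNK
    split_ifs <;> omega
  have high' : ∀ i, i ≠ t → m + k ≤ i + 1 → i ≤ K → σ i = ρ i ∧ m + k ≤ ρ i ∧ ρ i ≤ K := by
    intro i h1 h2 h3
    rcases Nat.eq_or_lt_of_le h2 with h4 | h4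
    · rw [mid1 i (by omega) (by omega), mid3 i (by omega) (by omega)]
      omega
    · have := high i h1 (by omega) h3
      omega
  have row : ∀ (τ : ℕ → ℕ) (i a b : ℕ), 1 ≤ i → i ≤ K - 1 → min (τ i) (τ (i + 1)) = a →
      max (τ i) (τ (i + 1)) = b →
      (petrie K τ).vecMulLinear (eB (K - 1) i) = JV (eB (K - 1)) a b := by
    rintro τ i a b h1 h2 rfl rfl
    exact petrie_row K τ i h1 h2
  have row1 : ∀ (τ : ℕ → ℕ) (i a : ℕ), 1 ≤ i → i ≤ K - 1 → min (τ i) (τ (i + 1)) = a →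
      max (τ i) (τ (i + 1)) = a + 1 →
      (petrie K τ).vecMulLinear (eB (K - 1) i) = eB (K - 1) a := by
    intro τ i a h1 h2 h3 h4
    rw [row τ i a (a + 1) h1 h2 h3 h4, JV_one]
  refine ⟨hn, hnk, by omega, ?_, ?_, ?_, ?_, ?_, ?_, ?_, ?_⟩
  · intro i h1 h2
    by_cases e1 : i = s
    · have l := low (i + 1) (by omega) (by omega) (by omega)
      subst e1
      refine Or.inr ⟨ρ (i + 1), by omega, by omega, ?_, ?_⟩ <;>
        apply row <;> omega
    · by_cases e2 : i + 1 = s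
      · have l := low i (by omega) (by omega) (by omega)
        subst e2
        refine Or.inr ⟨ρ i, by omega, by omega, ?_, ?_⟩ <;>
          apply row <;> omega
      · have l := low i (by omega) (by omega) (by omega)
        have l' := low (i + 1) (by omega) (by omega) (by omega)
        refine Or.inl ⟨min (ρ i) (ρ (i + 1)), max (ρ i) (ρ (i + 1)),
          by omega, by omega, by omega, ?_, ?_⟩ <;> apply row <;> omega
  · have l := low (m + 1) (by omega) (by omega) (by omega)
    have r1 := mid1 (m + 1 + 1) (by omega) (by omega)
    have r2 := mid2 (m + 1 + 1) (by omega) (by omega)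
    refine ⟨ρ (m + 1), by omega, by omega, ?_, ?_⟩ <;> apply row <;> omega
  · intro i h1 h2
    have r1 := mid1 i (by omega) (by omega)
    have r2 := mid1 (i + 1) (by omega) (by omega)
    apply row1 <;> omega
  · intro i h1 h2
    have r1 := mid2 (i + 1) (by omega) (by omega)
    have r2 := mid2 (i + 1 + 1) (by omega) (by omega)
    apply row1 <;> omega
  · have r1 := mid2 (m + n - 1) (by omega) (by omega)
    have r2 := mid3 (m + n) (by omega) (by omega)
    have r3 : m + n - 1 + 1 = m + n := by omega
    apply row
    · omega
    · omega
    · rw [r3]; omega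
    · rw [r3]; omega
  · intro i h1 h2
    have r1 := mid3 i (by omega) (by omega)
    have r2 := mid3 (i + 1) (by omega) (by omega)
    apply row1 <;> omega
  · intro i h1 h2
    by_cases e1 : i = t
    · have l := high' (i + 1) (by omega) (by omega) (by omega)
      subst e1
      refine Or.inr ⟨ρ (i + 1), by omega, by omega, ?_, ?_⟩ <;>
        apply row <;> omega
    · by_cases e2 : i + 1 = t
      · have l := high' i (by omega) (by omega) (by omega)
        subst e2
        refine Or.inr ⟨ρ i, by omega, by omega, ?_, ?_⟩ <;>
          apply row <;> omega
      · have l := high' i (by omega) (by omega) (by omega)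
        have l' := high' (i + 1) (by omega) (by omega) (by omega)
        refine Or.inl ⟨min (ρ i) (ρ (i + 1)), max (ρ i) (ρ (i + 1)),
          by omega, by omega, by omega, ?_, ?_⟩ <;> apply row <;> omega
  · obtain ⟨i, rfl⟩ : ∃ i, t = i + 1 := ⟨t - 1, by omega⟩
    have l := high' i (by omega) (by omega) (by omega)
    refine ⟨i, ρ i, by omega, by omega, by omega, by omega, ?_⟩
    apply row <;> omega

theorem sig_one (n k : ℕ) : sigmaNK n k 1 = n := by simp [sigmaNK]

theorem sig_last (n k : ℕ) (hn : 2 ≤ n) (hk : n + 1 ≤ k) : sigmaNK n k k = n - 1 := by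
  unfold sigmaNK
  split_ifs <;> omega

theorem sig_two (i k : ℕ) (h1 : 2 ≤ i) (h2 : i ≤ k - 1) : sigmaNK 2 k i = i + 1 := by
  unfold sigmaNK
  split_ifs <;> omega

theorem left_sim (k n : ℕ) (hn : 3 ≤ n) (hnk : n + 1 ≤ k) :
    LeftSimilar k (sigmaNK 2 k) (sigmaNK n k) := by
  rintro m hm σ ρ ⟨⟨pσ, mσ, -⟩, ⟨pρ, mρ, s', hs'1, hs'2, hs'3, hs'4⟩, s, hs1, hs2, hσs, hρs, hL⟩
  rw [sig_one] at hσs hρs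
  have hss : s = s' := by
    by_contra hne
    have := hs'4 s hne hs1 (by omega)
    omega
  subst hss
  refine similar_of_setup (m + k) m k n σ ρ pρ
    (setup_of_ext m k n (m + k) s (m + k) σ ρ hn hnk le_rfl hs1 hs2 hσs hρs le_rfl le_rfl
      ?_ ?_ ?_ ?_ ?_)
  · rw [mσ k (by omega) le_rfl, sig_last 2 k le_rfl (by omega)]
  · rw [mρ k (by omega) le_rfl, sig_last n k (by omega) (by omega)]
    omega
  · intro i h1 h2 h3
    have h4 : 1 ≤ ρ i ∧ ρ i ≤ m + k := pρ.mapsTo ⟨h2, by omega⟩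
    have := hs'4 i h1 h2 h3
    exact ⟨hL i h1 h2 h3, h4.1, by omega⟩
  · intro i h1 h2
    rw [mσ i h1 (by omega), sig_two i k h1 h2, mρ i h1 (by omega)]
    exact ⟨by omega, rfl⟩
  · intro i h1 h2 h3
    omega

theorem two_sim (k n : ℕ) (hn : 3 ≤ n) (hnk : n + 1 ≤ k) :
    TwoSidedSimilar k (sigmaNK 2 k) (sigmaNK n k) := by
  rintro m r hm hr σ ρ ⟨⟨pσ, mσ, -⟩, ⟨pρ, mρ, ⟨s', hs'1, hs'2, hs'3, hs'4⟩,
    ⟨t', ht'1, ht'2, ht'3, ht'4⟩⟩, s, t, hs1, hs2, ht1, ht2, hσs, hρs, hσt, hρt, hL⟩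
  rw [sig_one] at hσs hρs
  rw [sig_last _ _ (by omega) (by omega)] at hσt hρt
  have hss : s = s' := by
    by_contra hne
    have := hs'4 s hne hs1 (by omega)
    omega
  have htt : t = t' := by
    by_contra hne
    have := ht'4 t hne (by omega) (by omega)
    omega
  subst hss
  subst htt
  refine similar_of_setup (m + k + r) m k n σ ρ pρ
    (setup_of_ext m k n (m + k + r) s t σ ρ hn hnk (by omega) hs1 hs2 hσs hρs (by omega) ht2
      hσt (by omega) ?_ ?_ ?_)
  · intro i h1 h2 h3
    have h4 : 1 ≤ ρ i ∧ ρ i ≤ m + k + r := pρ.mapsTo ⟨h2, by omega⟩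
    have := hs'4 i h1 h2 h3
    exact ⟨hL i h1 (by omega) (Or.inl ⟨h2, h3⟩), h4.1, by omega⟩
  · intro i h1 h2
    rw [mσ i h1 (by omega), sig_two i k h1 h2, mρ i h1 (by omega)]
    exact ⟨by omega, rfl⟩
  · intro i h1 h2 h3
    have h4 : 1 ≤ ρ i ∧ ρ i ≤ m + k + r := pρ.mapsTo ⟨by omega, by omega⟩
    exact ⟨hL i (by omega) h1 (Or.inr ⟨h2, h3⟩), ht'4 i h1 h2 h3, h4.2⟩

/-- Theorem 8(2). -/
theorem sigma2K_sigmaNK_similar (k n : ℕ) (hk : 4 ≤ k) (hn : 3 ≤ n) (hn' : n ≤ k - 1) :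
    LeftSimilar k (sigmaNK 2 k) (sigmaNK n k) ∧
    TwoSidedSimilar k (sigmaNK 2 k) (sigmaNK n k) ∧
    ¬ RightSimilar k (sigmaNK 2 k) (sigmaNK n k) ∧
    (petrie k (sigmaNK 2 k)).trace ≠ (petrie k (sigmaNK n k)).trace ∧
    ¬ MatSimilar (petrie k (sigmaNK 2 k)) (petrie k (sigmaNK n k)) := by
  have hnk : n + 1 ≤ k := by omega
  have ht : (petrie k (sigmaNK 2 k)).trace ≠ (petrie k (sigmaNK n k)).trace := by
    rw [trace_two k (by omega), trace_n n k hn hnk]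
    norm_num
  exact ⟨left_sim k n hn hnk, two_sim k n hn hnk, not_right k n hn hnk, ht,
    fun h => ht (similar_trace h)⟩
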